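/- For every continuous U(1)-valued cocycle α : ℝⁿ → C(𝕋ⁿ, U(1)) there exists a unique continuous map β : ℝⁿ → C(𝕋ⁿ, ℝ) such that β(g+h)(z) = β(g)(z + p(h)) + β(h)(z) for all g, h ∈ ℝⁿ and z ∈ 𝕋ⁿ, and exp(2πi·β(g)(z)) = α(g)(z) for all g ∈ ℝⁿ and z ∈ 𝕋ⁿ. -/

import Mathlib

/-!
Every continuous `U(1)`-valued cocycle `α : ℝⁿ → C(𝕋ⁿ, U(1))` admits a unique
continuous `ℝ`-valued cocycle lift `β` with `exp(2πi·β(g)(z)) = α(g)(z)`.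
-/

noncomputable section

/-- The `n`-torus `𝕋ⁿ = ℝⁿ/ℤⁿ`. -/
abbrev Torus (n : ℕ) : Type := Fin n → AddCircle (1 : ℝ)

/-- The quotient homomorphism `p : ℝⁿ → 𝕋ⁿ`. -/
def torusProj (n : ℕ) : (Fin n → ℝ) → Torus n := fun v i => (v i : AddCircle (1 : ℝ))

open scoped unitInterval

/-- A circle-valued map on `E × Z`, with `E` a real topological vector space, that is trivial on
`{0} × Z` lifts through `Circle.exp` to a real-valued map vanishing on `{0} × Z`. -/
theorem exists_circleExp_lift_prod {E Z : Type*} [AddCommGroup E] [Module ℝ E]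
    [TopologicalSpace E] [ContinuousSMul ℝ E] [TopologicalSpace Z]
    (f : C(E × Z, Circle)) (hf : ∀ z, f (0, z) = 1) :
    ∃ F : C(E × Z, ℝ), (∀ z, F (0, z) = 0) ∧ ∀ x, Circle.exp (F x) = f x := by
  let H : C(I × (E × Z), Circle) := ⟨fun q ↦ f ((q.1 : ℝ) • q.2.1, q.2.2), by fun_prop⟩
  have H_zero : ∀ a, H (0, a) = Circle.exp (ContinuousMap.const (E × Z) (0 : ℝ) a) := fun a ↦ by
    simp [H, hf]
  let L := Circle.isCoveringMap_exp.liftHomotopy H (.const (E × Z) 0) H_zero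
  have exp_L : ∀ q, Circle.exp (L q) = H q :=
    congr_fun (Circle.isCoveringMap_exp.liftHomotopy_lifts H (.const (E × Z) 0) H_zero)
  have L_zero : ∀ a, L (0, a) = 0 := Circle.isCoveringMap_exp.liftHomotopy_zero H _ H_zero
  refine ⟨⟨fun x ↦ L (1, x), by fun_prop⟩, fun z ↦ ?_, fun x ↦ ?_⟩
  · have const := Circle.isCoveringMap_exp.const_of_comp (g := fun t : I ↦ L (t, (0, z)))
      (by fun_prop) (fun s t ↦ by simp [exp_L, H]) 1 0
    exact const.trans (L_zero _)
  · simp [exp_L, H]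

/-- Two real-valued continuous maps on a preconnected space that agree at one point and have the
same image under `x ↦ exp (2πix)` are equal. -/
theorem eq_of_circleExp_two_pi_mul_eq {X : Type*} [TopologicalSpace X] [PreconnectedSpace X]
    {u v : X → ℝ} (hu : Continuous u) (hv : Continuous v)
    (h : ∀ x, Circle.exp (2 * Real.pi * u x) = Circle.exp (2 * Real.pi * v x))
    (a : X) (ha : u a = v a) : u = v := by
  have key := Circle.isCoveringMap_exp.eq_of_comp_eq
    (g₁ := fun x ↦ 2 * Real.pi * u x) (g₂ := fun x ↦ 2 * Real.pi * v x)
    (by fun_prop) (by fun_prop) (funext h) a (by simp [ha])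
  funext x
  exact mul_left_cancel₀ Real.two_pi_pos.ne' (congr_fun key x)

theorem torusProj_zero (n : ℕ) : torusProj n 0 = 0 := by
  ext i; simp [torusProj]

theorem continuous_torusProj (n : ℕ) : Continuous (torusProj n) :=
  continuous_pi fun i ↦ (AddCircle.continuous_mk' 1).comp (continuous_apply i)

theorem exists_unique_real_cocycle_lift (n : ℕ)
    (α : C(Fin n → ℝ, C(Torus n, Circle)))
    (hα : ∀ (g h : Fin n → ℝ) (z : Torus n),
      α (g + h) z = α g (z + torusProj n h) * α h z) :
    ∃! β : C(Fin n → ℝ, C(Torus n, ℝ)),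
      (∀ (g h : Fin n → ℝ) (z : Torus n),
        β (g + h) z = β g (z + torusProj n h) + β h z) ∧
      (∀ (g : Fin n → ℝ) (z : Torus n),
        Circle.exp (2 * Real.pi * β g z) = α g z) := by
  have α_zero : ∀ z, α 0 z = 1 := fun z ↦ by simpa [torusProj_zero] using hα 0 0 z
  obtain ⟨F, F_zero, exp_F⟩ := exists_circleExp_lift_prod α.uncurry α_zero
  let β : C(Fin n → ℝ, C(Torus n, ℝ)) :=
    ContinuousMap.curry ⟨fun x ↦ F x / (2 * Real.pi), by fun_prop⟩
  have β_apply : ∀ g z, β g z = F (g, z) / (2 * Real.pi) := fun _ _ ↦ rfl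
  have β_zero : ∀ z, β 0 z = 0 := fun z ↦ by simp [β_apply, F_zero]
  have exp_β : ∀ g z, Circle.exp (2 * Real.pi * β g z) = α g z := fun g z ↦ by
    rw [β_apply, mul_div_cancel₀ _ Real.two_pi_pos.ne']
    exact exp_F (g, z)
  refine ⟨β, ⟨fun g h z ↦ ?_, exp_β⟩, fun γ ⟨γ_add, exp_γ⟩ ↦ ?_⟩
  · have := continuous_torusProj n
    have key := eq_of_circleExp_two_pi_mul_eq
      (u := fun x : (Fin n → ℝ) × (Fin n → ℝ) ↦ β (x.1 + x.2) z)
      (v := fun x ↦ β x.1 (z + torusProj n x.2) + β x.2 z)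
      (by simp only [β_apply]; fun_prop) (by simp only [β_apply]; fun_prop)
      (fun x ↦ by rw [mul_add, Circle.exp_add, exp_β, exp_β, exp_β, hα])
      (0, 0) (by simp [β_zero])
    exact congr_fun key (g, h)
  · have γ_zero : ∀ z, γ 0 z = 0 := fun z ↦ by simpa [torusProj_zero] using γ_add 0 0 z
    ext g z
    exact congr_fun (eq_of_circleExp_two_pi_mul_eq (u := fun g ↦ γ g z) (v := fun g ↦ β g z)
      (by fun_prop) (by fun_prop) (fun g ↦ by rw [exp_γ, exp_β]) 0
      (by rw [γ_zero, β_zero])) g
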